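/- Let ℓ ≥ 1, let F ⊆ ℕ^ℓ be finite with |F| ≥ 3, and let Z_F denote the number of homothetic copies of F contained in the binomial random subset ([n]^ℓ)_{q_n}. If the sequence (q_n) satisfies q_n·n^ℓ → ∞ and q_n^{|F|}·n^{ℓ+1} → ∞, then E[Z_F] ≤ q_n^{|F|}·n^{ℓ+1}, Var(Z_F) = O(q_n^{2|F|−1}·n^{ℓ+2} + q_n^{|F|}·n^{ℓ+1}), and the probability that Z_F ≥ 2·q_n^{|F|}·n^{ℓ+1} tends to 0 as n → ∞. -/

import Mathlib

open Finset Filter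

/-- The probability weight of obtaining exactly the subset `S` when each element of the
finite ground set `Γ` is included independently with probability `p`. -/
noncomputable def binomWeight {α : Type*} (Γ : Finset α) (p : ℝ) (S : Finset α) : ℝ :=
  p ^ S.card * (1 - p) ^ (Γ.card - S.card)

open Classical in
/-- The probability that the binomial random subset `Γ_p` satisfies the property `P`. -/
noncomputable def binomProb {α : Type*} (Γ : Finset α) (p : ℝ) (P : Finset α → Prop) : ℝ :=
  ∑ S ∈ Γ.powerset, if P S then binomWeight Γ p S else 0

/-- The expectation of `f` of the binomial random subset `Γ_p`. -/
noncomputable def binomExp {α : Type*} (Γ : Finset α) (p : ℝ) (f : Finset α → ℝ) : ℝ :=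
  ∑ S ∈ Γ.powerset, binomWeight Γ p S * f S

/-- `Z_F(S)`: the number of pairs `(y₀, λ)` with `λ ≥ 1` such that the homothetic copy
`y₀ + λ•F` is contained in `S ⊆ [n]^ℓ`. -/
def homPairCount (l n : ℕ) (F : Finset (Fin l → ℕ)) (S : Finset (Fin l → ℕ)) : ℕ :=
  (((Fintype.piFinset fun _ : Fin l => Finset.range (n + 1)) ×ˢ Finset.Icc 1 n).filter
    fun yl => ∀ f ∈ F, (fun j => yl.1 j + yl.2 * f j) ∈ S).card

/-- A fixed set `A ⊆ Γ` is contained in `Γ_p` with probability `p ^ |A|`. -/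
theorem binomExp_indicator_superset {α : Type*} [DecidableEq α] {Γ A : Finset α}
    (hA : A ⊆ Γ) (p : ℝ) :
    binomExp Γ p (fun S => if A ⊆ S then 1 else 0) = p ^ A.card := by
  have h := Finset.prod_add (fun _ : α => p) (fun i => if i ∈ A then 0 else 1 - p) Γ
  have hl : ∏ i ∈ Γ, (p + if i ∈ A then 0 else 1 - p) = p ^ A.card := by
    have : ∀ i ∈ Γ, (p + if i ∈ A then 0 else 1 - p) = if i ∈ A then p else 1 := by
      intro i _
      split_ifs <;> ring
    rw [Finset.prod_congr rfl this, Finset.prod_ite_mem, Finset.inter_eq_right.mpr hA,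
      Finset.prod_const]
  rw [← hl, h, binomExp]
  refine Finset.sum_congr rfl fun S hS => ?_
  have hS' := Finset.mem_powerset.mp hS
  rw [binomWeight, Finset.prod_const, mul_assoc]
  congr 1
  split_ifs with hAS
  · rw [mul_one, ← Finset.card_sdiff_of_subset hS', ← Finset.prod_const]
    refine Finset.prod_congr rfl fun i hi => ?_
    rw [if_neg fun hiA => (Finset.mem_sdiff.mp hi).2 (hAS hiA)]
  · obtain ⟨x, hxA, hxS⟩ := Finset.not_subset.mp hAS
    rw [mul_zero, Finset.prod_eq_zero (Finset.mem_sdiff.mpr ⟨hA hxA, hxS⟩)]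
    rw [if_pos hxA]

theorem binomExp_sum {α ι : Type*} (Γ : Finset α) (p : ℝ) (T : Finset ι)
    (f : ι → Finset α → ℝ) :
    binomExp Γ p (fun S => ∑ i ∈ T, f i S) = ∑ i ∈ T, binomExp Γ p (f i) := by
  simp only [binomExp, Finset.mul_sum]
  exact Finset.sum_comm

theorem binomExp_congr {α : Type*} {Γ : Finset α} (p : ℝ) {f g : Finset α → ℝ}
    (h : ∀ S ⊆ Γ, f S = g S) : binomExp Γ p f = binomExp Γ p g :=
  Finset.sum_congr rfl fun S hS => by rw [h S (Finset.mem_powerset.mp hS)]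

theorem sum_binomWeight {α : Type*} (Γ : Finset α) (p : ℝ) :
    ∑ S ∈ Γ.powerset, binomWeight Γ p S = 1 := by
  classical
  simpa [binomExp] using binomExp_indicator_superset (Finset.empty_subset Γ) p

theorem binomWeight_nonneg {α : Type*} (Γ S : Finset α) {p : ℝ} (h0 : 0 ≤ p) (h1 : p ≤ 1) :
    0 ≤ binomWeight Γ p S :=
  mul_nonneg (pow_nonneg h0 _) (pow_nonneg (by linarith) _)

/-- Chebyshev's inequality for the upper tail of a function of the binomial random subset. -/
theorem binomProb_mul_sq_le_variance {α : Type*} (Γ : Finset α) {p : ℝ} (h0 : 0 ≤ p)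
    (h1 : p ≤ 1) (f : Finset α → ℝ) {M t : ℝ} (ht : 0 ≤ t) (hM : binomExp Γ p f + t ≤ M) :
    binomProb Γ p (fun S => M ≤ f S) * t ^ 2 ≤
      binomExp Γ p (fun S => f S ^ 2) - binomExp Γ p f ^ 2 := by
  set m := binomExp Γ p f with hm
  have hvar : binomExp Γ p (fun S => f S ^ 2) - m ^ 2 =
      ∑ S ∈ Γ.powerset, binomWeight Γ p S * (f S - m) ^ 2 := by
    have : ∑ S ∈ Γ.powerset, binomWeight Γ p S * (f S - m) ^ 2 =
        binomExp Γ p (fun S => f S ^ 2) - 2 * m * binomExp Γ p f +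
          m ^ 2 * ∑ S ∈ Γ.powerset, binomWeight Γ p S := by
      simp only [binomExp, Finset.mul_sum, ← Finset.sum_sub_distrib, ← Finset.sum_add_distrib]
      exact Finset.sum_congr rfl fun S _ => by ring
    rw [this, sum_binomWeight, ← hm]
    ring
  rw [hvar, binomProb, Finset.sum_mul]
  refine Finset.sum_le_sum fun S _ => ?_
  have hw := binomWeight_nonneg Γ S h0 h1
  split_ifs with hS
  · refine mul_le_mul_of_nonneg_left ?_ hw
    exact pow_le_pow_left₀ ht (by linarith) 2
  · rw [zero_mul]
    positivity

theorem binomExp_card_filter {α ι : Type*} [DecidableEq α] {Γ : Finset α} (p : ℝ) (T : Finset ι)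
    {A : ι → Finset α} (hA : ∀ i ∈ T, A i ⊆ Γ) :
    binomExp Γ p (fun S => ((T.filter fun i => A i ⊆ S).card : ℝ)) =
      ∑ i ∈ T, p ^ (A i).card := by
  simp only [Finset.card_filter, Nat.cast_sum, Nat.cast_ite, Nat.cast_one, Nat.cast_zero]
  rw [binomExp_sum]
  exact Finset.sum_congr rfl fun i hi => binomExp_indicator_superset (hA i hi) p

theorem binomExp_card_filter_sq {α ι : Type*} [DecidableEq α] {Γ : Finset α} (p : ℝ) (T : Finset ι)
    {A : ι → Finset α} (hA : ∀ i ∈ T, A i ⊆ Γ) :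
    binomExp Γ p (fun S => ((T.filter fun i => A i ⊆ S).card : ℝ) ^ 2) =
      ∑ i ∈ T, ∑ j ∈ T, p ^ (A i ∪ A j).card := by
  have h : ∀ S, ((T.filter fun i => A i ⊆ S).card : ℝ) ^ 2 =
      (((T ×ˢ T).filter fun ij => A ij.1 ∪ A ij.2 ⊆ S).card : ℝ) := by
    intro S
    simp only [Finset.union_subset_iff]
    rw [Finset.filter_product (fun i => A i ⊆ S) (fun i => A i ⊆ S), Finset.card_product]
    push_cast
    ring
  simp only [h]
  rw [binomExp_card_filter p (T ×ˢ T) (A := fun ij => A ij.1 ∪ A ij.2), Finset.sum_product]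
  intro ij hij
  rw [Finset.mem_product] at hij
  exact Finset.union_subset (hA _ hij.1) (hA _ hij.2)

/-- The map `f ↦ y₀ + λ f` attached to the pair `(y₀, λ)`. -/
def homMap {l : ℕ} (a : (Fin l → ℕ) × ℕ) (f : Fin l → ℕ) : Fin l → ℕ :=
  fun j => a.1 j + a.2 * f j

theorem homMap_injective {l : ℕ} {a : (Fin l → ℕ) × ℕ} (ha : 1 ≤ a.2) :
    Function.Injective (homMap a) := by
  intro f g h
  funext j
  have hj : a.1 j + a.2 * f j = a.1 j + a.2 * g j := congrFun h j
  exact Nat.eq_of_mul_eq_mul_left ha (Nat.add_left_cancel hj)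

theorem eq_of_homMap_eq {l : ℕ} {a b : (Fin l → ℕ) × ℕ} {f : Fin l → ℕ} (h2 : a.2 = b.2)
    (h : homMap a f = homMap b f) : a = b := by
  refine Prod.ext (funext fun j => ?_) h2
  have hj : a.1 j + a.2 * f j = b.1 j + b.2 * f j := congrFun h j
  rw [h2] at hj
  exact Nat.add_right_cancel hj

theorem eq_of_homMap_eq_of_ne {l : ℕ} {a b : (Fin l → ℕ) × ℕ} {f g : Fin l → ℕ} (hfg : f ≠ g)
    (hf : homMap a f = homMap b f) (hg : homMap a g = homMap b g) : a = b := by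
  obtain ⟨j, hj⟩ := Function.ne_iff.mp hfg
  refine eq_of_homMap_eq ?_ hf
  have h1 : a.1 j + a.2 * f j = b.1 j + b.2 * f j := congrFun hf j
  have h2 : a.1 j + a.2 * g j = b.1 j + b.2 * g j := congrFun hg j
  zify at h1 h2 hj ⊢
  have h3 : ((a.2 : ℤ) - b.2) * (f j - g j) = 0 := by linear_combination h1 - h2
  rcases mul_eq_zero.mp h3 with h | h
  · linarith
  · exact absurd (by linarith) hj

/-- The pairs `(y₀, λ)` whose homothetic copy `y₀ + λF` lies in `[n]^ℓ`. -/
def homPairs (l n : ℕ) (F : Finset (Fin l → ℕ)) : Finset ((Fin l → ℕ) × ℕ) :=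
  ((Fintype.piFinset fun _ : Fin l => Finset.range (n + 1)) ×ˢ Finset.Icc 1 n).filter
    fun a => F.image (homMap a) ⊆ Fintype.piFinset fun _ : Fin l => Finset.Icc 1 n

theorem scale_mem_of_mem_homPairs {l n : ℕ} {F : Finset (Fin l → ℕ)} {a : (Fin l → ℕ) × ℕ}
    (ha : a ∈ homPairs l n F) : a.2 ∈ Finset.Icc 1 n :=
  (Finset.mem_product.mp (Finset.mem_filter.mp ha).1).2

theorem image_subset_of_mem_homPairs {l n : ℕ} {F : Finset (Fin l → ℕ)}
    {a : (Fin l → ℕ) × ℕ} (ha : a ∈ homPairs l n F) :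
    F.image (homMap a) ⊆ Fintype.piFinset fun _ : Fin l => Finset.Icc 1 n :=
  (Finset.mem_filter.mp ha).2

theorem card_image_of_mem_homPairs {l n : ℕ} {F : Finset (Fin l → ℕ)}
    {a : (Fin l → ℕ) × ℕ} (ha : a ∈ homPairs l n F) :
    (F.image (homMap a)).card = F.card :=
  Finset.card_image_of_injective _
    (homMap_injective (Finset.mem_Icc.mp (scale_mem_of_mem_homPairs ha)).1)

theorem homPairCount_eq {l n : ℕ} {F S : Finset (Fin l → ℕ)}
    (hS : S ⊆ Fintype.piFinset fun _ : Fin l => Finset.Icc 1 n) :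
    homPairCount l n F S = ((homPairs l n F).filter fun a => F.image (homMap a) ⊆ S).card := by
  rw [homPairCount, homPairs, Finset.filter_filter]
  congr 1
  refine Finset.filter_congr fun a _ => ?_
  rw [and_iff_right_of_imp fun h => h.trans hS, Finset.image_subset_iff]
  rfl

theorem card_homPairs_le {l : ℕ} (n : ℕ) {F : Finset (Fin l → ℕ)} (hF : F.Nonempty) :
    (homPairs l n F).card ≤ n ^ (l + 1) := by
  obtain ⟨f, hf⟩ := hF
  have h : (homPairs l n F).card ≤
      ((Fintype.piFinset fun _ : Fin l => Finset.Icc 1 n) ×ˢ Finset.Icc 1 n).card := by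
    refine Finset.card_le_card_of_injOn (fun a => (homMap a f, a.2)) (fun a ha => ?_) ?_
    · exact Finset.mem_coe.mpr (Finset.mem_product.mpr
        ⟨image_subset_of_mem_homPairs ha (Finset.mem_image_of_mem _ hf),
          scale_mem_of_mem_homPairs (a := a) (F := F) (Finset.mem_coe.mp ha)⟩)
    · intro a _ b _ hab
      obtain ⟨h1, h2⟩ := Prod.mk.inj hab
      exact eq_of_homMap_eq h2 h1
  simpa [pow_succ] using h

theorem card_homPairs_filter_homMap_eq_le {l n : ℕ} (F : Finset (Fin l → ℕ))
    (g x : Fin l → ℕ) : ((homPairs l n F).filter fun b => x = homMap b g).card ≤ n := by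
  have h : ((homPairs l n F).filter fun b => x = homMap b g).card ≤ (Finset.Icc 1 n).card := by
    refine Finset.card_le_card_of_injOn Prod.snd (fun b hb => ?_) ?_
    · exact scale_mem_of_mem_homPairs (Finset.mem_filter.mp hb).1
    · intro a ha b hb hab
      exact eq_of_homMap_eq hab
        ((Finset.mem_filter.mp ha).2.symm.trans (Finset.mem_filter.mp hb).2)
  simpa using h

theorem card_homPairs_filter_homMap_eq_eq_le {l n : ℕ} (F : Finset (Fin l → ℕ))
    (g g' : Fin l → ℕ) {x x' : Fin l → ℕ} (hx : x ≠ x') :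
    ((homPairs l n F).filter fun b => x = homMap b g ∧ x' = homMap b g').card ≤ 1 := by
  refine Finset.card_le_one.mpr fun a ha b hb => ?_
  obtain ⟨-, hax, hax'⟩ := Finset.mem_filter.mp ha
  obtain ⟨-, hbx, hbx'⟩ := Finset.mem_filter.mp hb
  have hg : g ≠ g' := by
    rintro rfl
    exact hx (hax.trans hax'.symm)
  exact eq_of_homMap_eq_of_ne hg (hax.symm.trans hbx) (hax'.symm.trans hbx')

/-- A fixed copy meets at most `|F|² n` copies of `F`. -/
theorem card_homPairs_meeting_le {l n : ℕ} (F : Finset (Fin l → ℕ)) (a : (Fin l → ℕ) × ℕ) :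
    ((homPairs l n F).filter fun b =>
      (F.image (homMap a) ∩ F.image (homMap b)).Nonempty).card ≤ F.card ^ 2 * n := by
  have hsub : ((homPairs l n F).filter fun b =>
      (F.image (homMap a) ∩ F.image (homMap b)).Nonempty) ⊆
      (F ×ˢ F).biUnion fun fg => (homPairs l n F).filter fun b =>
        homMap a fg.1 = homMap b fg.2 := by
    intro b hb
    obtain ⟨hb, x, hx⟩ := Finset.mem_filter.mp hb
    obtain ⟨h1, h2⟩ := Finset.mem_inter.mp hx
    obtain ⟨f, hf, rfl⟩ := Finset.mem_image.mp h1
    obtain ⟨g, hg, hfg⟩ := Finset.mem_image.mp h2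
    exact Finset.mem_biUnion.mpr ⟨(f, g), Finset.mem_product.mpr ⟨hf, hg⟩,
      Finset.mem_filter.mpr ⟨hb, hfg.symm⟩⟩
  refine (Finset.card_le_card hsub).trans ((Finset.card_biUnion_le_card_mul _ _ n
    fun fg _ => card_homPairs_filter_homMap_eq_le F fg.2 _).trans_eq ?_)
  rw [Finset.card_product, sq]

/-- A fixed copy meets at most `|F|⁴` copies of `F` in two or more points. -/
theorem card_homPairs_meeting_twice_le {l n : ℕ} (F : Finset (Fin l → ℕ))
    (a : (Fin l → ℕ) × ℕ) :
    ((homPairs l n F).filter fun b =>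
      1 < (F.image (homMap a) ∩ F.image (homMap b)).card).card ≤ F.card ^ 4 := by
  have hsub : ((homPairs l n F).filter fun b =>
      1 < (F.image (homMap a) ∩ F.image (homMap b)).card) ⊆
      (((F ×ˢ F) ×ˢ (F ×ˢ F)).filter fun v => homMap a v.1.1 ≠ homMap a v.1.2).biUnion
        fun v => (homPairs l n F).filter fun b =>
          homMap a v.1.1 = homMap b v.2.1 ∧ homMap a v.1.2 = homMap b v.2.2 := by
    intro b hb
    obtain ⟨hb, hcard⟩ := Finset.mem_filter.mp hb
    obtain ⟨x, hx, y, hy, hxy⟩ := Finset.one_lt_card.mp hcard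
    obtain ⟨hx1, hx2⟩ := Finset.mem_inter.mp hx
    obtain ⟨hy1, hy2⟩ := Finset.mem_inter.mp hy
    obtain ⟨f, hf, rfl⟩ := Finset.mem_image.mp hx1
    obtain ⟨g, hg, hfg⟩ := Finset.mem_image.mp hx2
    obtain ⟨f', hf', rfl⟩ := Finset.mem_image.mp hy1
    obtain ⟨g', hg', hfg'⟩ := Finset.mem_image.mp hy2
    refine Finset.mem_biUnion.mpr ⟨((f, f'), (g, g')), ?_,
      Finset.mem_filter.mpr ⟨hb, hfg.symm, hfg'.symm⟩⟩
    simp [hf, hf', hg, hg', hxy]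
  refine (Finset.card_le_card hsub).trans ((Finset.card_biUnion_le_card_mul _ _ 1
    fun v hv => card_homPairs_filter_homMap_eq_eq_le F v.2.1 v.2.2
      (Finset.mem_filter.mp hv).2).trans ?_)
  rw [mul_one]
  refine (Finset.card_filter_le _ _).trans_eq ?_
  simp only [Finset.card_product]
  ring

/-- The covariance of the indicators of two `k`-sets, bounded by the size of their
intersection. -/
theorem pow_card_union_sub_le {α : Type*} [DecidableEq α] {A B : Finset α} {k : ℕ}
    (hA : A.card = k) (hB : B.card = k) {p : ℝ} (h0 : 0 ≤ p) (h1 : p ≤ 1) :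
    p ^ (A ∪ B).card - p ^ k * p ^ k ≤
      (if (A ∩ B).Nonempty then p ^ (2 * k - 1) else 0) +
        (if 1 < (A ∩ B).card then p ^ k else 0) := by
  have hcard := Finset.card_union_add_card_inter A B
  have hk : 0 ≤ p ^ k * p ^ k := by positivity
  have hk' : 0 ≤ p ^ (2 * k - 1) := by positivity
  rcases Nat.lt_trichotomy (A ∩ B).card 1 with h | h | h
  · have he : A ∩ B = ∅ := Finset.card_eq_zero.mp (by omega)
    have : (A ∪ B).card = k + k := by omega
    simp [he, this, pow_add]
  · have hne : (A ∩ B).Nonempty := Finset.card_pos.mp (by omega)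
    have : (A ∪ B).card = 2 * k - 1 := by omega
    simp [hne, h, this, hk]
  · have hne : (A ∩ B).Nonempty := Finset.card_pos.mp (by omega)
    have hle : k ≤ (A ∪ B).card := hA ▸ Finset.card_le_card Finset.subset_union_left
    have := pow_le_pow_of_le_one h0 h1 hle
    rw [if_pos hne, if_pos h]
    linarith

theorem binomExp_homPairCount {l : ℕ} (n : ℕ) (F : Finset (Fin l → ℕ)) (p : ℝ) :
    binomExp (Fintype.piFinset fun _ : Fin l => Finset.Icc 1 n) p
      (fun S => (homPairCount l n F S : ℝ)) = (homPairs l n F).card * p ^ F.card := by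
  rw [binomExp_congr p fun S hS => congrArg Nat.cast (homPairCount_eq hS),
    binomExp_card_filter p _ (A := fun a => F.image (homMap a)) fun a ha =>
      image_subset_of_mem_homPairs ha,
    Finset.sum_congr rfl fun a ha => congrArg (p ^ ·) (card_image_of_mem_homPairs ha),
    Finset.sum_const, nsmul_eq_mul]

theorem binomExp_homPairCount_le {l : ℕ} (n : ℕ) {F : Finset (Fin l → ℕ)} (hF : F.Nonempty)
    {p : ℝ} (h0 : 0 ≤ p) :
    binomExp (Fintype.piFinset fun _ : Fin l => Finset.Icc 1 n) p
      (fun S => (homPairCount l n F S : ℝ)) ≤ p ^ F.card * (n : ℝ) ^ (l + 1) := by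
  rw [binomExp_homPairCount, mul_comm]
  exact mul_le_mul_of_nonneg_left (mod_cast card_homPairs_le n hF) (pow_nonneg h0 _)

theorem variance_homPairCount_le {l : ℕ} (n : ℕ) {F : Finset (Fin l → ℕ)} (hF : F.Nonempty)
    {p : ℝ} (h0 : 0 ≤ p) (h1 : p ≤ 1) :
    binomExp (Fintype.piFinset fun _ : Fin l => Finset.Icc 1 n) p
        (fun S => (homPairCount l n F S : ℝ) ^ 2) -
      (binomExp (Fintype.piFinset fun _ : Fin l => Finset.Icc 1 n) p
        (fun S => (homPairCount l n F S : ℝ))) ^ 2 ≤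
      (F.card : ℝ) ^ 4 * (p ^ (2 * F.card - 1) * (n : ℝ) ^ (l + 2) +
        p ^ F.card * (n : ℝ) ^ (l + 1)) := by
  set T := homPairs l n F
  set k := F.card
  have hk1 : (1 : ℝ) ≤ k := by exact_mod_cast hF.card_pos
  have hsq : ((T.card : ℝ) * p ^ k) ^ 2 = ∑ a ∈ T, ∑ b ∈ T, p ^ k * p ^ k := by
    simp only [Finset.sum_const, nsmul_eq_mul]
    ring
  have hrow : ∀ a ∈ T, ∑ b ∈ T, (p ^ (F.image (homMap a) ∪ F.image (homMap b)).card -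
      p ^ k * p ^ k) ≤ (k : ℝ) ^ 4 * (n * p ^ (2 * k - 1) + p ^ k) := by
    intro a ha
    refine (Finset.sum_le_sum fun b hb => pow_card_union_sub_le
      (card_image_of_mem_homPairs ha) (card_image_of_mem_homPairs hb) h0 h1).trans ?_
    rw [Finset.sum_add_distrib, ← Finset.sum_filter, ← Finset.sum_filter, Finset.sum_const,
      Finset.sum_const, nsmul_eq_mul, nsmul_eq_mul, mul_add, ← mul_assoc]
    have hone : ((T.filter fun b =>
        (F.image (homMap a) ∩ F.image (homMap b)).Nonempty).card : ℝ) ≤ (k : ℝ) ^ 2 * n := by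
      exact_mod_cast card_homPairs_meeting_le F a
    have htwo : ((T.filter fun b =>
        1 < (F.image (homMap a) ∩ F.image (homMap b)).card).card : ℝ) ≤ (k : ℝ) ^ 4 := by
      exact_mod_cast card_homPairs_meeting_twice_le F a
    have hpow : (k : ℝ) ^ 2 ≤ (k : ℝ) ^ 4 := pow_le_pow_right₀ hk1 (by norm_num)
    have hone' := hone.trans (mul_le_mul_of_nonneg_right hpow (Nat.cast_nonneg n))
    gcongr
  have hTcard : (T.card : ℝ) ≤ (n : ℝ) ^ (l + 1) := by exact_mod_cast card_homPairs_le n hF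
  rw [binomExp_homPairCount,
    binomExp_congr p fun S hS => congrArg (fun m : ℕ => (m : ℝ) ^ 2) (homPairCount_eq hS),
    binomExp_card_filter_sq p _ (A := fun a => F.image (homMap a))
      fun a ha => image_subset_of_mem_homPairs ha, hsq,
    ← Finset.sum_sub_distrib,
    Finset.sum_congr rfl fun _ _ => (Finset.sum_sub_distrib _ _).symm]
  calc _ ≤ ∑ _a ∈ T, (k : ℝ) ^ 4 * (n * p ^ (2 * k - 1) + p ^ k) := Finset.sum_le_sum hrow
    _ = T.card * ((k : ℝ) ^ 4 * (n * p ^ (2 * k - 1) + p ^ k)) := by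
      rw [Finset.sum_const, nsmul_eq_mul]
    _ ≤ (n : ℝ) ^ (l + 1) * ((k : ℝ) ^ 4 * (n * p ^ (2 * k - 1) + p ^ k)) := by gcongr
    _ = _ := by ring

theorem binomProb_nonneg {α : Type*} (Γ : Finset α) {p : ℝ} (h0 : 0 ≤ p) (h1 : p ≤ 1)
    (P : Finset α → Prop) : 0 ≤ binomProb Γ p P := by
  refine Finset.sum_nonneg fun S _ => ?_
  split_ifs
  · exact binomWeight_nonneg Γ S h0 h1
  · exact le_rfl

/-- First- and second-moment estimates for the number `Z_F` of homothetic copies of `F`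
in the binomial random subset of `[n]^ℓ`, and the resulting upper tail bound. -/
theorem homothetic_copies_second_moment (l : ℕ) (hl : 1 ≤ l) (F : Finset (Fin l → ℕ))
    (hF : 3 ≤ F.card) (q : ℕ → ℝ) (hq : ∀ n, 0 ≤ q n ∧ q n ≤ 1)
    (h1 : Tendsto (fun n => q n * (n : ℝ) ^ l) atTop atTop)
    (h2 : Tendsto (fun n => q n ^ F.card * (n : ℝ) ^ (l + 1)) atTop atTop) :
    (∀ n : ℕ, binomExp (Fintype.piFinset fun _ : Fin l => Finset.Icc 1 n) (q n)
        (fun S => (homPairCount l n F S : ℝ)) ≤ q n ^ F.card * (n : ℝ) ^ (l + 1)) ∧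
    (∃ Cv : ℝ, 0 < Cv ∧ ∀ᶠ n in atTop,
      binomExp (Fintype.piFinset fun _ : Fin l => Finset.Icc 1 n) (q n)
          (fun S => (homPairCount l n F S : ℝ) ^ 2) -
        (binomExp (Fintype.piFinset fun _ : Fin l => Finset.Icc 1 n) (q n)
          (fun S => (homPairCount l n F S : ℝ))) ^ 2 ≤
        Cv * (q n ^ (2 * F.card - 1) * (n : ℝ) ^ (l + 2) +
          q n ^ F.card * (n : ℝ) ^ (l + 1))) ∧
    Tendsto (fun n => binomProb (Fintype.piFinset fun _ : Fin l => Finset.Icc 1 n) (q n)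
      (fun S => 2 * q n ^ F.card * (n : ℝ) ^ (l + 1) ≤ (homPairCount l n F S : ℝ)))
      atTop (nhds 0) := by
  have hne : F.Nonempty := Finset.card_pos.mp (by omega)
  refine ⟨fun n => binomExp_homPairCount_le n hne (hq n).1,
    ⟨(F.card : ℝ) ^ 4, by have := hne.card_pos; positivity, Filter.Eventually.of_forall fun n =>
      variance_homPairCount_le n hne (hq n).1 (hq n).2⟩, ?_⟩
  have hlim : Tendsto (fun n => (F.card : ℝ) ^ 4 * ((q n * (n : ℝ) ^ l)⁻¹ +
      (q n ^ F.card * (n : ℝ) ^ (l + 1))⁻¹)) atTop (nhds 0) := by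
    simpa using (h1.inv_tendsto_atTop.add h2.inv_tendsto_atTop).const_mul ((F.card : ℝ) ^ 4)
  refine tendsto_of_tendsto_of_tendsto_of_le_of_le' tendsto_const_nhds hlim
    (Filter.Eventually.of_forall fun n => binomProb_nonneg _ (hq n).1 (hq n).2 _) ?_
  filter_upwards [h1.eventually_gt_atTop 0, eventually_gt_atTop 0] with n hn hn0
  have hn0' : (0 : ℝ) < n := Nat.cast_pos.mpr hn0
  have hqn : 0 < q n := pos_of_mul_pos_left hn (by positivity)
  have hM : 0 < q n ^ F.card * (n : ℝ) ^ (l + 1) := by positivity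
  have hmean := binomExp_homPairCount_le n hne (hq n).1
  have hcheb := (binomProb_mul_sq_le_variance _ (hq n).1 (hq n).2 _ hM.le
    (by linarith : _ ≤ 2 * q n ^ F.card * (n : ℝ) ^ (l + 1))).trans
    (variance_homPairCount_le n hne (hq n).1 (hq n).2)
  refine ((le_div_iff₀ (by positivity)).mpr hcheb).trans_eq ?_
  obtain ⟨k, hk⟩ : ∃ k, F.card = k + 1 := ⟨F.card - 1, by omega⟩
  rw [hk, show 2 * (k + 1) - 1 = 2 * k + 1 by omega]
  field_simp
  ring
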